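/- arXiv:1601.03199 — 2 statements merged into one kernel-verified Lean document; each statement's English description precedes it below -/
import Mathlib

section
/- The function λ(x) = log(1 − (2/x)·Ψ(x)) / log Ψ(x), where Ψ(x) = I₁(x)/I₀(x), satisfies lim_{x→∞} λ(x) = 4. -/
open Real Filter Topology

/-- The modified Bessel function of the first kind of real order `ν`. -/
noncomputable def besselI (ν x : ℝ) : ℝ :=
  ∑' m : ℕ, (x / 2) ^ (2 * (m : ℝ) + ν) / ((m.factorial : ℝ) * Real.Gamma ((m : ℝ) + ν + 1))

/-- `Ψ_ν(x) = I_{ν+1}(x) / I_ν(x)`. -/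
noncomputable def psi (ν x : ℝ) : ℝ := besselI (ν + 1) x / besselI ν x

theorem ev_le_of_deriv {f f' : ℝ → ℝ} {a b X : ℝ} (hb : 0 < b)
    (hf : ∀ x, X ≤ x → HasDerivAt f (f' x) x)
    (hle : ∀ x, X ≤ x → f' x ≤ a - b * f x) {ε : ℝ} (hε : 0 < ε) :
    ∀ᶠ x in atTop, f x ≤ a / b + ε := by
  have hd : ∀ x, X ≤ x → HasDerivAt (fun x => Real.exp (b * x) * (f x - a / b))
      (Real.exp (b * x) * b * (f x - a / b) + Real.exp (b * x) * f' x) x := by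
    intro x hx
    have h1 : HasDerivAt (fun x => Real.exp (b * x)) (Real.exp (b * x) * b) x := by
      simpa using ((hasDerivAt_id x).const_mul b).exp
    exact h1.mul ((hf x hx).sub_const (a / b))
  have hanti : AntitoneOn (fun x => Real.exp (b * x) * (f x - a / b)) (Set.Ici X) := by
    apply antitoneOn_of_deriv_nonpos (convex_Ici X)
    · intro x hx
      exact (hd x hx).continuousAt.continuousWithinAt
    · intro x hx
      rw [interior_Ici] at hx
      exact (hd x (le_of_lt hx)).differentiableAt.differentiableWithinAt
    · intro x hx
      rw [interior_Ici] at hx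
      have hx' : X ≤ x := le_of_lt hx
      rw [(hd x hx').deriv]
      have h2 : b * (f x - a / b) + f' x ≤ 0 := by
        have := hle x hx'
        have h3 : b * (a / b) = a := by field_simp
        nlinarith
      have := mul_nonpos_of_nonneg_of_nonpos (Real.exp_pos (b * x)).le h2
      nlinarith
  set C := Real.exp (b * X) * (f X - a / b) with hC
  have ht : Tendsto (fun x => Real.exp (b * x) * ε) atTop atTop :=
    (Real.tendsto_exp_atTop.comp (tendsto_id.const_mul_atTop hb)).atTop_mul_const hε
  filter_upwards [ht.eventually_ge_atTop C, eventually_ge_atTop X] with x h1 h2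
  have h3 : Real.exp (b * x) * (f x - a / b) ≤ C := hanti (Set.mem_Ici.2 le_rfl) h2 h2
  have h4 : f x - a / b ≤ ε := le_of_mul_le_mul_left (h3.trans h1) (Real.exp_pos _)
  linarith

/-- If `u' = 1 - 2u + u²/x` and `u ≤ x`, then `u → 1/2`. -/
theorem tendsto_half {u : ℝ → ℝ}
    (hu : ∀ x, 1 ≤ x → HasDerivAt u (1 - 2 * u x + u x ^ 2 / x) x)
    (hux : ∀ x, 1 ≤ x → u x ≤ x) : Tendsto u atTop (𝓝 (1 / 2)) := by
  have lower : ∀ ε : ℝ, 0 < ε → ∀ᶠ x in atTop, 1 / 2 - ε ≤ u x := by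
    intro ε hε
    have := ev_le_of_deriv (f := fun x => - u x) (a := -1) (b := 2) (X := 1) two_pos
      (fun x hx => (hu x hx).neg) (fun x hx => by
        have : 0 ≤ u x ^ 2 / x := by positivity
        linarith) hε
    filter_upwards [this] with x hx
    linarith
  have pos := lower (1 / 2) (by norm_num)
  obtain ⟨X, hX⟩ := eventually_atTop.1 pos
  have bdd : ∀ᶠ x in atTop, u x ≤ 2 := by
    have := ev_le_of_deriv (f := u) (a := 1) (b := 1) (X := max 1 X) one_pos
      (fun x hx => hu x (le_trans (le_max_left _ _) hx)) (fun x hx => by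
        have h1 : 1 ≤ x := le_trans (le_max_left _ _) hx
        have h2 : 0 ≤ u x := by
          have := hX x (le_trans (le_max_right _ _) hx)
          linarith
        have h3 := hux x h1
        have : u x ^ 2 / x ≤ u x := by
          rw [div_le_iff₀ (by linarith)]
          nlinarith
        linarith) one_pos
    filter_upwards [this] with x hx
    linarith
  obtain ⟨Y, hY⟩ := eventually_atTop.1 bdd
  have upper : ∀ ε : ℝ, 0 < ε → ∀ᶠ x in atTop, u x ≤ 1 / 2 + ε := by
    intro ε hε
    have := ev_le_of_deriv (f := u) (a := 1 + ε) (b := 2) (X := max (max 1 (4 / ε)) (max X Y))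
      two_pos (fun x hx => hu x (by simp only [max_le_iff] at hx; exact hx.1.1)) (fun x hx => by
        simp only [max_le_iff] at hx
        obtain ⟨⟨h1, h2⟩, h3, h4⟩ := hx
        have h5 := hX x h3
        have h6 := hY x h4
        have : u x ^ 2 / x ≤ ε := by
          rw [div_le_iff₀ (by linarith)]
          rw [div_le_iff₀ hε] at h2
          nlinarith
        linarith) (half_pos hε)
    filter_upwards [this] with x hx
    linarith
  rw [Metric.tendsto_nhds]
  intro ε hε
  filter_upwards [lower (ε / 2) (half_pos hε), upper (ε / 2) (half_pos hε)] with x h1 h2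
  rw [Real.dist_eq, abs_lt]
  constructor <;> linarith

theorem final_limit {p : ℝ → ℝ} (hp : Tendsto (fun x => x * (1 - p x)) atTop (𝓝 (1 / 2))) :
    Tendsto (fun x : ℝ => Real.log (1 - (2 / x) * p x) / Real.log (p x)) atTop (𝓝 4) := by
  have hp1 : Tendsto p atTop (𝓝 1) := by
    have h := (tendsto_inv_atTop_zero (𝕜 := ℝ)).mul hp
    have h2 := (tendsto_const_nhds (x := (1 : ℝ))).sub h
    simp only [zero_mul, sub_zero] at h2
    refine h2.congr' ?_
    filter_upwards [eventually_gt_atTop 0] with x hx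
    field_simp
    ring
  have hA : Tendsto (fun x => x * Real.log (1 + (-(2 / x) * p x))) atTop (𝓝 (-2)) := by
    apply Real.tendsto_mul_log_one_add_of_tendsto
    have := hp1.const_mul (-2)
    rw [mul_one] at this
    refine this.congr' ?_
    filter_upwards [eventually_gt_atTop 0] with x hx
    field_simp
  have hB : Tendsto (fun x => x * Real.log (1 + (p x - 1))) atTop (𝓝 (-(1 / 2))) := by
    apply Real.tendsto_mul_log_one_add_of_tendsto
    refine hp.neg.congr ?_
    intro x
    ring
  have := hA.div hB (by norm_num)
  rw [show (-2 : ℝ) / (-(1 / 2)) = 4 by norm_num] at this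
  refine this.congr' ?_
  filter_upwards [eventually_gt_atTop 0] with x hx
  simp only [Pi.div_apply]
  rw [mul_div_mul_left _ _ hx.ne']
  congr 2 <;> ring

theorem summable_of_coeff {c : ℕ → ℝ} (hc : ∀ m, |c m| ≤ 1 / (m.factorial : ℝ)) (x : ℝ) :
    Summable (fun m => c m * x ^ m) := by
  refine Summable.of_norm_bounded (Real.summable_pow_div_factorial |x|) ?_
  intro m
  rw [Real.norm_eq_abs, abs_mul, abs_pow, div_eq_inv_mul, ← one_div]
  exact mul_le_mul_of_nonneg_right (hc m) (by positivity)

theorem hasDerivAt_series {c : ℕ → ℝ} (hc : ∀ m, |c m| ≤ 1 / (m.factorial : ℝ)) (x : ℝ) :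
    HasDerivAt (fun x => ∑' m, c m * x ^ m) (∑' m : ℕ, ((m : ℝ) + 1) * c (m + 1) * x ^ m) x := by
  set R := |x| + 1 with hR
  have hsum : Summable (fun m : ℕ => |c m| * (m * R ^ (m - 1))) := by
    rw [← summable_nat_add_iff 1]
    refine Summable.of_nonneg_of_le (fun m => by positivity) ?_
      (Real.summable_pow_div_factorial R)
    intro m
    simp only [Nat.add_sub_cancel]
    calc |c (m + 1)| * (((m + 1 : ℕ) : ℝ) * R ^ m)
        ≤ 1 / ((m + 1).factorial : ℝ) * (((m + 1 : ℕ) : ℝ) * R ^ m) :=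
          mul_le_mul_of_nonneg_right (hc _) (by positivity)
      _ = R ^ m / m.factorial := by
          rw [Nat.factorial_succ]
          push_cast
          have : (m.factorial : ℝ) ≠ 0 := by positivity
          field_simp
  have hx : x ∈ Metric.ball (0 : ℝ) R := by
    rw [mem_ball_zero_iff, Real.norm_eq_abs]
    linarith
  have key := hasDerivAt_tsum_of_isPreconnected (g := fun (m : ℕ) (x : ℝ) => c m * x ^ m)
    (g' := fun (m : ℕ) (x : ℝ) => c m * (m * x ^ (m - 1))) hsum Metric.isOpen_ball
    (convex_ball (0 : ℝ) R).isPreconnected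
    (fun m y _ => (hasDerivAt_pow m y).const_mul (c m))
    (fun m y hy => by
      rw [mem_ball_zero_iff, Real.norm_eq_abs] at hy
      rw [Real.norm_eq_abs, abs_mul, abs_mul, abs_pow, Nat.abs_cast]
      gcongr) hx (summable_of_coeff hc x) hx
  have hs : Summable (fun m : ℕ => c m * (m * x ^ (m - 1))) := by
    refine Summable.of_norm_bounded hsum ?_
    intro m
    rw [Real.norm_eq_abs, abs_mul, abs_mul, abs_pow, Nat.abs_cast]
    have : |x| ≤ R := by linarith
    gcongr
  refine key.congr_deriv ?_
  rw [hs.tsum_eq_zero_add]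
  simp only [Nat.cast_zero, zero_mul, mul_zero, zero_add, Nat.add_sub_cancel]
  refine tsum_congr fun m => ?_
  push_cast
  ring

noncomputable def gC (m : ℕ) : ℝ := 1 / (m.factorial : ℝ) ^ 2
noncomputable def kC (m : ℕ) : ℝ := m / (m.factorial : ℝ) ^ 2

theorem gC_bd (m : ℕ) : |gC m| ≤ 1 / (m.factorial : ℝ) := by
  have h : (1 : ℝ) ≤ m.factorial := by exact_mod_cast m.factorial_pos
  rw [gC, abs_of_nonneg (by positivity)]
  apply one_div_le_one_div_of_le (by positivity)
  nlinarith

theorem kC_bd (m : ℕ) : |kC m| ≤ 1 / (m.factorial : ℝ) := by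
  have h : (m : ℝ) ≤ m.factorial := by exact_mod_cast m.self_le_factorial
  have h0 : (0 : ℝ) < m.factorial := by positivity
  rw [kC, abs_of_nonneg (by positivity), div_le_div_iff₀ (by positivity) h0]
  nlinarith

noncomputable def G (t : ℝ) : ℝ := ∑' m, gC m * t ^ m
noncomputable def K (t : ℝ) : ℝ := ∑' m, kC m * t ^ m
noncomputable def H (t : ℝ) : ℝ := ∑' m : ℕ, ((m : ℝ) + 1) * gC (m + 1) * t ^ m

theorem hasDerivAt_G (t : ℝ) : HasDerivAt G (H t) t := hasDerivAt_series gC_bd t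

theorem hasDerivAt_K (t : ℝ) : HasDerivAt K (G t) t := by
  have := hasDerivAt_series kC_bd t
  refine HasDerivAt.congr_deriv this ?_
  refine tsum_congr fun m => ?_
  rw [gC, kC, Nat.factorial_succ]
  push_cast
  have : (m.factorial : ℝ) ≠ 0 := by positivity
  field_simp

theorem K_eq (t : ℝ) : K t = t * H t := by
  rw [K, (summable_of_coeff kC_bd t).tsum_eq_zero_add, H, ← tsum_mul_left]
  simp only [kC, gC, Nat.cast_zero, zero_div, zero_mul, zero_add]
  refine tsum_congr fun m => ?_
  push_cast
  ring

theorem G_pos {t : ℝ} (ht : 0 ≤ t) : 0 < G t := by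
  refine (summable_of_coeff gC_bd t).tsum_pos (fun m => ?_) 0 ?_
  · unfold gC; positivity
  · simp [gC]

theorem H_nonneg {t : ℝ} (ht : 0 ≤ t) : 0 ≤ H t := by
  refine tsum_nonneg fun m => ?_
  unfold gC; positivity

theorem bessel0 {x : ℝ} (hx : 0 < x) : besselI 0 x = G (x ^ 2 / 4) := by
  unfold besselI G
  refine tsum_congr fun m => ?_
  rw [add_zero, add_zero, Real.Gamma_nat_eq_factorial, gC,
    show (2 * (m : ℝ)) = ((2 * m : ℕ) : ℝ) by push_cast; ring, Real.rpow_natCast, pow_mul,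
    show (x / 2) ^ 2 = x ^ 2 / 4 by ring]
  ring

theorem bessel1 {x : ℝ} (hx : 0 < x) : besselI 1 x = x / 2 * H (x ^ 2 / 4) := by
  unfold besselI H
  rw [← tsum_mul_left]
  refine tsum_congr fun m => ?_
  rw [show (m : ℝ) + 1 + 1 = ((m + 1 : ℕ) : ℝ) + 1 by push_cast; ring,
    Real.Gamma_nat_eq_factorial, gC,
    show (2 * (m : ℝ) + 1) = ((2 * m + 1 : ℕ) : ℝ) by push_cast; ring, Real.rpow_natCast,
    pow_succ, pow_mul, show (x / 2) ^ 2 = x ^ 2 / 4 by ring, Nat.factorial_succ]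
  push_cast
  have : (m.factorial : ℝ) ≠ 0 := by positivity
  field_simp

noncomputable def Q (x : ℝ) : ℝ := 2 / x * K (x ^ 2 / 4) / G (x ^ 2 / 4)

theorem psi_eq {x : ℝ} (hx : 0 < x) : psi 0 x = Q x := by
  rw [psi, zero_add, bessel0 hx, bessel1 hx, Q, K_eq]
  congr 1
  field_simp
  ring

theorem Q_nonneg {x : ℝ} (hx : 0 < x) : 0 ≤ Q x := by
  have h1 := G_pos (t := x ^ 2 / 4) (by positivity)
  have h2 := H_nonneg (t := x ^ 2 / 4) (by positivity)
  rw [Q, K_eq]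
  positivity

theorem hasDerivAt_Q {x : ℝ} (hx : 0 < x) : HasDerivAt Q (1 - Q x / x - Q x ^ 2) x := by
  have hq : HasDerivAt (fun x : ℝ => x ^ 2 / 4) (x / 2) x := by
    have := (hasDerivAt_pow 2 x).div_const 4
    refine HasDerivAt.congr_deriv this ?_
    norm_num
    ring
  have hG := (hasDerivAt_G (x ^ 2 / 4)).comp x hq
  have hK := (hasDerivAt_K (x ^ 2 / 4)).comp x hq
  have hi : HasDerivAt (fun x : ℝ => 2 / x) (-(2 / x ^ 2)) x := by
    have := (hasDerivAt_inv hx.ne').const_mul 2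
    refine HasDerivAt.congr_deriv this ?_
    ring
  have h1 := G_pos (t := x ^ 2 / 4) (by positivity)
  have := (hi.mul hK).div hG h1.ne'
  refine HasDerivAt.congr_deriv this ?_
  simp only [Function.comp_apply, Q, Pi.mul_apply, K_eq]
  generalize G (x ^ 2 / 4) = g at *
  generalize H (x ^ 2 / 4) = h at *
  have := h1.ne'
  field_simp
  ring

theorem stmt_8 :
    Filter.Tendsto (fun x : ℝ => Real.log (1 - (2 / x) * psi 0 x) / Real.log (psi 0 x))
      Filter.atTop (nhds 4) := by
  apply final_limit
  have : Tendsto (fun x => x * (1 - Q x)) atTop (𝓝 (1 / 2)) := by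
    apply tendsto_half
    · intro x hx
      have hx0 : 0 < x := by linarith
      have := (hasDerivAt_id x).mul ((hasDerivAt_Q hx0).const_sub 1)
      refine HasDerivAt.congr_deriv this ?_
      simp only [id]
      field_simp
      ring
    · intro x hx
      have := Q_nonneg (x := x) (by linarith)
      nlinarith
  refine this.congr' ?_
  filter_upwards [eventually_gt_atTop 0] with x hx
  rw [psi_eq hx]
end

section
/- For every ν ≥ 0, the function ξ_ν(x) = log(1 − (2(ν+1)/x)·Ψ_ν(x)) / log Ψ_ν(x), where Ψ_ν(x) = I_{ν+1}(x)/I_ν(x), satisfies lim_{x→∞} ξ_ν(x) = 4(ν+1)/(2ν+1). -/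
open Real Filter Topology

noncomputable def auxF (ν t : ℝ) : ℝ :=
  ∑' m : ℕ, t ^ m / ((m.factorial : ℝ) * Real.Gamma ((m : ℝ) + ν + 1))

lemma gamma_lower (ν : ℝ) (hν : 0 ≤ ν) (m : ℕ) :
    Real.Gamma (ν + 1) ≤ Real.Gamma ((m : ℝ) + ν + 1) := by
  induction m with
  | zero => simp
  | succ k ih =>
    have hk : (0 : ℝ) ≤ k := Nat.cast_nonneg k
    have h1 : (((k + 1 : ℕ) : ℝ) + ν + 1) = ((k : ℝ) + ν + 1) + 1 := by push_cast; ring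
    rw [h1, Real.Gamma_add_one (s := (k : ℝ) + ν + 1) (by positivity)]
    have h2 : 0 < Real.Gamma ((k : ℝ) + ν + 1) := Real.Gamma_pos_of_pos (by positivity)
    nlinarith [mul_nonneg (add_nonneg hk hν) h2.le]

lemma term_bound (ν : ℝ) (hν : 0 ≤ ν) (m : ℕ) (a : ℝ) (ha : 0 ≤ a) :
    a / ((m.factorial : ℝ) * Real.Gamma ((m : ℝ) + ν + 1))
      ≤ a / (m.factorial : ℝ) * (1 / Real.Gamma (ν + 1)) := by
  have h0 : 0 < Real.Gamma (ν + 1) := Real.Gamma_pos_of_pos (by positivity)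
  have h1 := gamma_lower ν hν m
  have h2 : (0 : ℝ) < m.factorial := by positivity
  rw [div_mul_div_comm, mul_one]
  gcongr

lemma auxF_summable (ν : ℝ) (hν : 0 ≤ ν) (t : ℝ) :
    Summable (fun m : ℕ => t ^ m / ((m.factorial : ℝ) * Real.Gamma ((m : ℝ) + ν + 1))) := by
  apply Summable.of_norm_bounded
    (g := fun m : ℕ => |t| ^ m / (m.factorial : ℝ) * (1 / Real.Gamma (ν + 1)))
  · exact (Real.summable_pow_div_factorial |t|).mul_right _
  · intro m
    have h2 : 0 < Real.Gamma ((m : ℝ) + ν + 1) := Real.Gamma_pos_of_pos (by positivity)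
    rw [Real.norm_eq_abs, abs_div, abs_pow,
      abs_of_pos (show 0 < (m.factorial : ℝ) * Real.Gamma ((m : ℝ) + ν + 1) by positivity)]
    exact term_bound ν hν m _ (by positivity)

lemma shift_term (ν : ℝ) (t : ℝ) (m : ℕ) :
    ((m + 1 : ℕ) : ℝ) * t ^ m / (((m + 1).factorial : ℝ) * Real.Gamma (((m + 1 : ℕ) : ℝ) + ν + 1))
      = t ^ m / ((m.factorial : ℝ) * Real.Gamma ((m : ℝ) + (ν + 1) + 1)) := by
  have h1 : (((m + 1 : ℕ) : ℝ) + ν + 1) = ((m : ℝ) + (ν + 1) + 1) := by push_cast; ring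
  rw [h1, Nat.factorial_succ]
  push_cast
  have : (m : ℝ) + 1 ≠ 0 := by positivity
  rw [mul_assoc, mul_div_mul_left _ _ this]

lemma auxF_deriv (ν : ℝ) (hν : 0 ≤ ν) (t : ℝ) :
    HasDerivAt (auxF ν) (auxF (ν + 1) t) t := by
  set R := |t| + 1 with hR
  have hR0 : 0 ≤ R := by positivity
  have hval : auxF (ν + 1) t = ∑' m : ℕ, (m : ℝ) * t ^ (m - 1) /
      ((m.factorial : ℝ) * Real.Gamma ((m : ℝ) + ν + 1)) := by
    rw [tsum_eq_zero_add']
    · simp only [Nat.cast_zero, zero_mul, zero_div, zero_add, Nat.add_sub_cancel, shift_term]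
      rfl
    · simp only [Nat.add_sub_cancel, shift_term]
      exact auxF_summable (ν + 1) (by positivity) t
  rw [hval]
  have hu : Summable (fun m : ℕ => (m : ℝ) * R ^ (m - 1) /
      ((m.factorial : ℝ) * Real.Gamma ((m : ℝ) + ν + 1))) := by
    rw [← summable_nat_add_iff 1]
    simp only [Nat.add_sub_cancel, shift_term]
    exact auxF_summable (ν + 1) (by positivity) R
  unfold auxF
  apply hasDerivAt_tsum_of_isPreconnected
    (g' := fun (m : ℕ) (t : ℝ) => (m : ℝ) * t ^ (m - 1) /
      ((m.factorial : ℝ) * Real.Gamma ((m : ℝ) + ν + 1)))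
    (g := fun (m : ℕ) (t : ℝ) => t ^ m / ((m.factorial : ℝ) * Real.Gamma ((m : ℝ) + ν + 1)))
    (t := Metric.ball 0 R) (y₀ := t) hu Metric.isOpen_ball
    (convex_ball (0 : ℝ) R).isPreconnected
  · intro m y _
    exact (hasDerivAt_pow m y).div_const _
  · intro m y hy
    have hy' : |y| ≤ R := by
      have := mem_ball_zero_iff.1 hy
      exact this.le
    have h2 : 0 < Real.Gamma ((m : ℝ) + ν + 1) := Real.Gamma_pos_of_pos (by positivity)
    rw [Real.norm_eq_abs, abs_div, abs_mul, abs_pow, Nat.abs_cast,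
      abs_of_pos (show 0 < (m.factorial : ℝ) * Real.Gamma ((m : ℝ) + ν + 1) by positivity)]
    gcongr
  · rw [mem_ball_zero_iff, Real.norm_eq_abs]; linarith
  · exact auxF_summable ν hν t
  · rw [mem_ball_zero_iff, Real.norm_eq_abs]; linarith

lemma auxF_rec (ν : ℝ) (hν : 0 ≤ ν) (t : ℝ) :
    auxF ν t = (ν + 1) * auxF (ν + 1) t + t * auxF (ν + 1 + 1) t := by
  have hs1 := auxF_summable (ν + 1) (by positivity) t
  have hs2 := auxF_summable (ν + 1 + 1) (by positivity) t
  have h2 : HasSum (fun m : ℕ => (m : ℝ) * t ^ m /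
      ((m.factorial : ℝ) * Real.Gamma ((m : ℝ) + (ν + 1) + 1))) (t * auxF (ν + 1 + 1) t) := by
    rw [← hasSum_nat_add_iff' 1]
    simp only [Finset.range_one, Finset.sum_singleton, Nat.cast_zero, zero_mul, zero_div, sub_zero]
    have h4 : HasSum _ (t * auxF (ν + 1 + 1) t) := hs2.hasSum.mul_left t
    have he : ∀ m : ℕ, ((m + 1 : ℕ) : ℝ) * t ^ (m + 1) / (((m + 1).factorial : ℝ) *
        Real.Gamma (((m + 1 : ℕ) : ℝ) + (ν + 1) + 1)) = t * (t ^ m / ((m.factorial : ℝ) *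
        Real.Gamma ((m : ℝ) + (ν + 1 + 1) + 1))) := by
      intro m
      rw [← shift_term]
      ring
    simp only [he]
    exact h4
  have h1 : HasSum _ ((ν + 1) * auxF (ν + 1) t) := hs1.hasSum.mul_left (ν + 1)
  have h3 := h1.add h2
  rw [← h3.tsum_eq, auxF]
  congr 1
  ext m
  have hg : Real.Gamma ((m : ℝ) + (ν + 1) + 1)
      = ((m : ℝ) + ν + 1) * Real.Gamma ((m : ℝ) + ν + 1) := by
    rw [← Real.Gamma_add_one (s := (m : ℝ) + ν + 1) (by positivity)]
    congr 1
    ring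
  have hp : 0 < Real.Gamma ((m : ℝ) + ν + 1) := Real.Gamma_pos_of_pos (by positivity)
  have hf : (0 : ℝ) < m.factorial := by positivity
  have hq : 0 < (m : ℝ) + ν + 1 := by positivity
  rw [hg]
  field_simp
  ring

lemma auxF_pos (ν : ℝ) (hν : 0 ≤ ν) (t : ℝ) (ht : 0 ≤ t) : 0 < auxF ν t := by
  apply (auxF_summable ν hν t).tsum_pos (i := 0)
  · intro m
    have h2 : 0 < Real.Gamma ((m : ℝ) + ν + 1) := Real.Gamma_pos_of_pos (by positivity)
    positivity
  · have h2 : 0 < Real.Gamma (((0 : ℕ) : ℝ) + ν + 1) := Real.Gamma_pos_of_pos (by positivity)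
    positivity

lemma bessel_eq (ν : ℝ) (hν : 0 ≤ ν) (x : ℝ) (hx : 0 ≤ x) :
    besselI ν x = (x / 2) ^ ν * auxF ν ((x / 2) ^ 2) := by
  rw [besselI, auxF, ← tsum_mul_left]
  congr 1
  ext m
  rw [Real.rpow_add_of_nonneg (by positivity) (by positivity) hν, ← pow_mul]
  have : (x / 2) ^ (2 * (m : ℝ)) = (x / 2) ^ (2 * m) := by
    rw [← Real.rpow_natCast]; push_cast; rfl
  rw [this]; ring

lemma bessel_pos (ν : ℝ) (hν : 0 ≤ ν) (x : ℝ) (hx : 0 < x) : 0 < besselI ν x := by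
  rw [bessel_eq ν hν x hx.le]
  have := auxF_pos ν hν ((x / 2) ^ 2) (by positivity)
  positivity

lemma bessel_rec (ν : ℝ) (hν : 0 ≤ ν) (x : ℝ) (hx : 0 < x) :
    besselI ν x = 2 * (ν + 1) / x * besselI (ν + 1) x + besselI (ν + 1 + 1) x := by
  rw [bessel_eq ν hν x hx.le, bessel_eq (ν + 1) (by positivity) x hx.le,
    bessel_eq (ν + 1 + 1) (by positivity) x hx.le, auxF_rec ν hν,
    Real.rpow_add_one (y := ν + 1) (by positivity), Real.rpow_add_one (y := ν) (by positivity)]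
  field_simp

lemma bessel_deriv (ν : ℝ) (hν : 0 ≤ ν) (x : ℝ) (hx : 0 < x) :
    HasDerivAt (besselI ν) (ν / x * besselI ν x + besselI (ν + 1) x) x := by
  have h1 : HasDerivAt (fun x : ℝ => x / 2) (1 / 2) x := (hasDerivAt_id x).div_const 2
  have h2 := h1.rpow_const (p := ν) (Or.inl (by positivity))
  have h3 := (auxF_deriv ν hν ((x / 2) ^ 2)).comp x (h1.pow 2)
  have h4 := h2.mul h3
  have h5 : HasDerivAt (besselI ν) _ x := h4.congr_of_eventuallyEq (by
    filter_upwards [lt_mem_nhds hx] with y hy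
    exact bessel_eq ν hν y hy.le)
  convert h5 using 1
  rw [bessel_eq ν hν x hx.le, bessel_eq (ν + 1) (by positivity) x hx.le,
    Real.rpow_add_one (by positivity), Real.rpow_sub_one (by positivity)]
  simp only [Function.comp, Pi.pow_apply]
  field_simp
  try ring

lemma bessel_deriv' (ν : ℝ) (hν : 0 ≤ ν) (x : ℝ) (hx : 0 < x) :
    HasDerivAt (besselI (ν + 1)) (besselI ν x - (ν + 1) / x * besselI (ν + 1) x) x := by
  convert bessel_deriv (ν + 1) (by positivity) x hx using 1
  rw [bessel_rec ν hν x hx]; ring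

lemma bessel_cont (ν : ℝ) (hν : 0 ≤ ν) : ContinuousOn (besselI ν) (Set.Ici 0) := by
  have hF : Continuous (auxF ν) :=
    continuous_iff_continuousAt.2 fun t => (auxF_deriv ν hν t).continuousAt
  have : Continuous (fun x : ℝ => (x / 2) ^ ν * auxF ν ((x / 2) ^ 2)) :=
    ((Real.continuous_rpow_const hν).comp (continuous_id.div_const 2)).mul
      (hF.comp ((continuous_id.div_const 2).pow 2))
  exact this.continuousOn.congr fun x hx => bessel_eq ν hν x hx

lemma bessel_le (ν : ℝ) (hν : 0 ≤ ν) (x : ℝ) (hx : 0 < x) :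
    besselI (ν + 1) x ≤ besselI ν x := by
  have hmono : MonotoneOn (fun x => besselI ν x ^ 2 - besselI (ν + 1) x ^ 2) (Set.Ici 0) := by
    apply monotoneOn_of_hasDerivWithinAt_nonneg (convex_Ici 0)
      (((bessel_cont ν hν).pow 2).sub ((bessel_cont (ν + 1) (by positivity)).pow 2))
      (f' := fun x => 2 * ν / x * besselI ν x ^ 2 + 2 * (ν + 1) / x * besselI (ν + 1) x ^ 2)
    · intro y hy
      rw [interior_Ici] at hy
      have hy : 0 < y := hy
      have := ((bessel_deriv ν hν y hy).pow 2).sub ((bessel_deriv' ν hν y hy).pow 2)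
      refine (this.congr_deriv ?_).hasDerivWithinAt
      push_cast
      ring
    · intro y hy
      rw [interior_Ici] at hy
      have hy : 0 < y := hy
      positivity
  have h := hmono (Set.self_mem_Ici) (show x ∈ Set.Ici 0 from hx.le) hx.le
  have h0 : besselI (ν + 1) 0 = 0 := by
    rw [bessel_eq _ (by positivity) _ le_rfl, zero_div, Real.zero_rpow (by positivity), zero_mul]
  simp only [h0] at h
  have := bessel_pos ν hν x hx
  refine le_of_sq_le_sq ?_ this.le
  nlinarith [sq_nonneg (besselI ν 0)]

noncomputable def auxE (ν x : ℝ) : ℝ :=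
  x ^ 2 * (besselI ν x ^ 2 - besselI (ν + 1) x ^ 2)
    - (2 * ν + 1) * (x * (besselI ν x * besselI (ν + 1) x))

lemma auxE_deriv (ν : ℝ) (hν : 0 ≤ ν) (x : ℝ) (hx : 0 < x) :
    HasDerivAt (auxE ν) (x * (besselI ν x ^ 2 - besselI (ν + 1) x ^ 2)) x := by
  have hA := bessel_deriv ν hν x hx
  have hB := bessel_deriv' ν hν x hx
  have := ((hasDerivAt_pow 2 x).mul ((hA.pow 2).sub (hB.pow 2))).sub
    (((hasDerivAt_id x).mul (hA.mul hB)).const_mul (2 * ν + 1))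
  refine this.congr_deriv ?_
  simp only [Pi.pow_apply, Pi.sub_apply, Pi.mul_apply, id]
  push_cast
  field_simp
  ring

lemma psi_le (ν : ℝ) (hν : 0 ≤ ν) (x : ℝ) (hx : 0 < x) : psi ν x ≤ 1 :=
  (div_le_one (bessel_pos ν hν x hx)).2 (bessel_le ν hν x hx)

lemma bessel_upper (ν : ℝ) (hν : 0 ≤ ν) (x : ℝ) (hx : 0 < x) :
    x * besselI ν x ≤ (x + 2 * (ν + 1)) * besselI (ν + 1) x := by
  have h1 := bessel_rec ν hν x hx
  have h2 := bessel_le (ν + 1) (by positivity) x hx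
  have h3 : x * besselI ν x = 2 * (ν + 1) * besselI (ν + 1) x + x * besselI (ν + 1 + 1) x := by
    rw [h1]; field_simp
  nlinarith

lemma psi_lower (ν : ℝ) (hν : 0 ≤ ν) (x : ℝ) (hx : 0 < x) :
    1 - 2 * (ν + 1) / x ≤ psi ν x := by
  have h1 := bessel_upper ν hν x hx
  have h2 := bessel_le ν hν x hx
  have h3 := bessel_pos ν hν x hx
  rw [psi, le_div_iff₀ h3]
  rw [sub_mul, one_mul, div_mul_eq_mul_div, sub_le_iff_le_add, ← sub_le_iff_le_add',
    le_div_iff₀ hx]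
  nlinarith

lemma psi_tendsto (ν : ℝ) (hν : 0 ≤ ν) : Tendsto (psi ν) atTop (𝓝 1) := by
  have h : Tendsto (fun x : ℝ => 1 - 2 * (ν + 1) / x) atTop (𝓝 1) := by
    simpa using (tendsto_const_nhds (x := (1 : ℝ))).sub
      ((tendsto_const_nhds (x := 2 * (ν + 1))).div_atTop tendsto_id)
  refine tendsto_of_tendsto_of_tendsto_of_le_of_le' h tendsto_const_nhds ?_ ?_
  · filter_upwards [eventually_gt_atTop 0] with x hx using psi_lower ν hν x hx
  · filter_upwards [eventually_gt_atTop 0] with x hx using psi_le ν hν x hx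

lemma auxE_bound (ν : ℝ) (hν : 0 ≤ ν) :
    ∃ C : ℝ, ∃ x₀ : ℝ, 0 < x₀ ∧ ∀ x, x₀ ≤ x → |auxE ν x| ≤ C * besselI ν x ^ 2 := by
  set x₀ : ℝ := 4 * (ν + 1) with hx₀
  have h0 : 0 < x₀ := by positivity
  have hI0 := bessel_pos ν hν x₀ h0
  have hdE : ∀ x, x₀ ≤ x → HasDerivAt (auxE ν) _ x := fun x hx =>
    auxE_deriv ν hν x (h0.trans_le hx)
  have hEmono : MonotoneOn (auxE ν) (Set.Ici x₀) := by
    apply monotoneOn_of_hasDerivWithinAt_nonneg (convex_Ici x₀)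
      (fun x hx => (hdE x hx).continuousAt.continuousWithinAt)
      (fun x hx => (hdE x (interior_subset hx)).hasDerivWithinAt)
    intro x hx
    have hx : 0 < x := h0.trans_le (interior_subset hx)
    have h1 := bessel_le ν hν x hx
    have h2 := bessel_pos (ν + 1) (by positivity) x hx
    have : besselI (ν + 1) x ^ 2 ≤ besselI ν x ^ 2 := by gcongr
    exact mul_nonneg hx.le (by linarith)
  have hd2 : ∀ x, x₀ ≤ x → HasDerivAt (fun x => besselI ν x ^ 2) _ x := fun x hx =>
    (bessel_deriv ν hν x (h0.trans_le hx)).pow 2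
  have hImono : MonotoneOn (fun x => besselI ν x ^ 2) (Set.Ici x₀) := by
    apply monotoneOn_of_hasDerivWithinAt_nonneg (convex_Ici x₀)
      (fun x hx => (hd2 x hx).continuousAt.continuousWithinAt)
      (fun x hx => (hd2 x (interior_subset hx)).hasDerivWithinAt)
    intro x hx
    have hx : 0 < x := h0.trans_le (interior_subset hx)
    have h1 := bessel_pos ν hν x hx
    have h2 := bessel_pos (ν + 1) (by positivity) x hx
    positivity
  have hd3 : ∀ x, x₀ ≤ x →
      HasDerivAt (fun x => 4 * (ν + 1) * besselI ν x ^ 2 - auxE ν x) _ x := fun x hx =>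
    ((hd2 x hx).const_mul (4 * (ν + 1))).sub (hdE x hx)
  have hDmono : MonotoneOn (fun x => 4 * (ν + 1) * besselI ν x ^ 2 - auxE ν x) (Set.Ici x₀) := by
    apply monotoneOn_of_hasDerivWithinAt_nonneg (convex_Ici x₀)
      (fun x hx => (hd3 x hx).continuousAt.continuousWithinAt)
      (fun x hx => (hd3 x (interior_subset hx)).hasDerivWithinAt)
    intro x hx
    have hxx : x₀ ≤ x := interior_subset hx
    have hx : 0 < x := h0.trans_le hxx
    have h1 := bessel_pos ν hν x hx
    have h2 := bessel_pos (ν + 1) (by positivity) x hx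
    have h3 := bessel_le ν hν x hx
    have h4 := bessel_upper ν hν x hx
    have h5 : besselI ν x ≤ 2 * besselI (ν + 1) x := by
      have : x * besselI ν x ≤ x * (2 * besselI (ν + 1) x) := by nlinarith
      exact le_of_mul_le_mul_left this hx
    have h6 : x * (besselI ν x - besselI (ν + 1) x) ≤ 2 * (ν + 1) * besselI ν x := by nlinarith
    have h7 : x * (besselI ν x ^ 2 - besselI (ν + 1) x ^ 2)
        ≤ 4 * (ν + 1) * besselI ν x ^ 2 := by
      calc _ = x * (besselI ν x - besselI (ν + 1) x) * (besselI ν x + besselI (ν + 1) x) := by ring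
        _ ≤ 2 * (ν + 1) * besselI ν x * (2 * besselI ν x) := by
          gcongr; linarith
        _ = _ := by ring
    have h8 : 0 ≤ ν / x * besselI ν x := by positivity
    have h9 : besselI ν x ^ 2 ≤
        2 * besselI ν x * (ν / x * besselI ν x + besselI (ν + 1) x) := by nlinarith
    have h10 := mul_le_mul_of_nonneg_left h9 (show 0 ≤ 4 * (ν + 1) by positivity)
    push_cast
    rw [pow_one]
    linarith
  set K := |auxE ν x₀| / besselI ν x₀ ^ 2 with hK
  have hK0 : 0 ≤ K := by positivity
  refine ⟨4 * (ν + 1) + K, x₀, h0, fun x hx => ?_⟩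
  have e1 := hEmono Set.self_mem_Ici hx hx
  have e2 : besselI ν x₀ ^ 2 ≤ besselI ν x ^ 2 := hImono Set.self_mem_Ici hx hx
  have e3 : 4 * (ν + 1) * besselI ν x₀ ^ 2 - auxE ν x₀ ≤ 4 * (ν + 1) * besselI ν x ^ 2 - auxE ν x :=
    hDmono Set.self_mem_Ici hx hx
  have e4 : |auxE ν x₀| ≤ K * besselI ν x ^ 2 := by
    calc |auxE ν x₀| = K * besselI ν x₀ ^ 2 := by rw [hK]; field_simp
      _ ≤ _ := by gcongr
  have e5 : 0 ≤ 4 * (ν + 1) * besselI ν x₀ ^ 2 := by positivity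
  have e6 : 0 ≤ 4 * (ν + 1) * besselI ν x ^ 2 := by positivity
  have e7 := abs_le.1 e4
  rw [abs_le]
  constructor <;> linarith [e7.1, e7.2]

lemma psi_asymp (ν : ℝ) (hν : 0 ≤ ν) :
    Tendsto (fun x => x * (1 - psi ν x)) atTop (𝓝 ((2 * ν + 1) / 2)) := by
  obtain ⟨C, x₀, h0, hC⟩ := auxE_bound ν hν
  have hE : Tendsto (fun x => auxE ν x / besselI ν x ^ 2 / x) atTop (𝓝 0) := by
    apply squeeze_zero_norm' (a := fun x => C / x)
    · filter_upwards [eventually_ge_atTop x₀] with x hx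
      have hx0 := h0.trans_le hx
      have := bessel_pos ν hν x hx0
      rw [Real.norm_eq_abs, abs_div, abs_div, abs_of_pos hx0, abs_of_pos (pow_pos this 2)]
      gcongr
      rw [div_le_iff₀ (by positivity)]
      exact hC x hx
    · exact tendsto_const_nhds.div_atTop tendsto_id
  have hp := psi_tendsto ν hν
  have h := (hE.add (hp.const_mul (2 * ν + 1))).div (hp.const_add 1) (by norm_num)
  have hl : (0 + (2 * ν + 1) * 1) / (1 + 1) = (2 * ν + 1) / 2 := by ring
  rw [hl] at h
  refine h.congr' ?_
  filter_upwards [eventually_gt_atTop 0] with x hx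
  have h1 := bessel_pos ν hν x hx
  have h2 := bessel_pos (ν + 1) (by positivity) x hx
  have h3 : 0 < psi ν x := div_pos h2 h1
  have h4 : besselI (ν + 1) x = psi ν x * besselI ν x := by rw [psi]; field_simp
  simp only [Pi.div_apply]
  rw [div_eq_iff (by positivity), auxE, h4]
  field_simp
  ring

/-- If `x * u x → c` with `u → 0` then `x * log (1 - u x) → -c`. -/
lemma log_asymp (u : ℝ → ℝ) (c : ℝ) (h : Tendsto (fun x => x * u x) atTop (𝓝 c)) :
    Tendsto (fun x => x * Real.log (1 - u x)) atTop (𝓝 (-c)) := by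
  have := Real.tendsto_mul_log_one_add_of_tendsto (g := fun x => - u x) (t := -c)
    (by simpa using h.neg)
  simpa [sub_eq_add_neg] using this

theorem stmt_18 (ν : ℝ) (hν : 0 ≤ ν) :
    Filter.Tendsto
      (fun x : ℝ => Real.log (1 - (2 * (ν + 1) / x) * psi ν x) / Real.log (psi ν x))
      Filter.atTop (nhds (4 * (ν + 1) / (2 * ν + 1))) := by
  have h1 := log_asymp (fun x => 1 - psi ν x) _ (psi_asymp ν hν)
  have h2 := log_asymp (fun x => (2 * (ν + 1) / x) * psi ν x) (2 * (ν + 1) * 1) (by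
    refine ((psi_tendsto ν hν).const_mul (2 * (ν + 1))).congr' ?_
    filter_upwards [eventually_gt_atTop 0] with x hx
    field_simp)
  have h := h2.div h1 (by have : 0 < (2 * ν + 1) / 2 := by positivity
                          linarith)
  have hl : -(2 * (ν + 1) * 1) / -((2 * ν + 1) / 2) = 4 * (ν + 1) / (2 * ν + 1) := by
    field_simp; ring
  rw [hl] at h
  refine h.congr' ?_
  filter_upwards [eventually_gt_atTop 0] with x hx
  simp only [Pi.div_apply, sub_sub_cancel]
  rw [mul_div_mul_left _ _ hx.ne']
end
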